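/- (Theorem 6, items 2 and 3: monotonicity of the α-fair tradeoff curve.) Let n ≥ 2, α ≥ 1, and define F_α*(θ; n) = sup{ F_α(x(p)) : p ∈ (0,1)^n, T(x(p)) = θ }. Then: (a) for all θ, θ' with θ_n < θ < θ' < 1, F_α*(θ'; n) < F_α*(θ; n) (the optimal α-fair objective is strictly decreasing in the target throughput on (θ_n, 1)); and (b) for every θ ∈ (θ_n, 1), F_α*(θ; n+1) < F_α*(θ; n) (for fixed α and θ the optimal α-fair objective is decreasing in the number of users). -/

import Mathlib

open scoped BigOperators

/-- The worst-case service rate of user `i` under control `p`. -/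
noncomputable def rate {n : ℕ} (p : Fin n → ℝ) (i : Fin n) : ℝ :=
  p i * ∏ j ∈ Finset.univ.erase i, (1 - p j)

/-- The throughput of the rate vector of control `p`. -/
noncomputable def tput {n : ℕ} (p : Fin n → ℝ) : ℝ := ∑ i, rate p i

/-- The `α`-fair utility function. -/
noncomputable def Ualpha (α z : ℝ) : ℝ :=
  if α = 1 then Real.log z else z ^ (1 - α) / (1 - α)

/-- The `α`-fair objective (sum-user utility). -/
noncomputable def Falpha (α : ℝ) {n : ℕ} (x : Fin n → ℝ) : ℝ := ∑ i, Ualpha α (x i)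

/-- The critical throughput `θ_t = (1 - 1/t)^(t-1)`. -/
noncomputable def crit (t : ℕ) : ℝ := (1 - 1 / (t : ℝ)) ^ (t - 1)

/-- The optimized α-fair objective under the throughput equality constraint. -/
noncomputable def FAstar (n : ℕ) (α θ : ℝ) : ℝ :=
  sSup {v : ℝ | ∃ p : Fin n → ℝ, (∀ i, p i ∈ Set.Ioo (0:ℝ) 1) ∧
    tput p = θ ∧ v = Falpha α (fun i => rate p i)}

/-- The tangent-line inequality for `Ualpha α` in the logarithmic variable. -/
theorem Ualpha_le_add_log_sub {α : ℝ} (hα : 1 ≤ α) {z w : ℝ} (hz : 0 < z) (hw : 0 < w) :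
    Ualpha α z ≤ Ualpha α w + w ^ (1 - α) * (Real.log z - Real.log w) := by
  unfold Ualpha
  split_ifs with h
  · subst h
    simp
  · have hα' : 1 - α < 0 := by
      have := lt_of_le_of_ne hα (Ne.symm h)
      linarith
    have hexp : 1 + (1 - α) * (Real.log z - Real.log w) ≤ (z / w) ^ (1 - α) := by
      rw [Real.rpow_def_of_pos (div_pos hz hw), Real.log_div hz.ne' hw.ne']
      linarith [Real.add_one_le_exp ((Real.log z - Real.log w) * (1 - α))]
    rw [Real.div_rpow hz.le hw.le, le_div_iff₀ (Real.rpow_pos_of_pos hw _)] at hexp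
    rw [div_le_iff_of_neg hα', add_mul, div_mul_cancel₀ _ hα'.ne]
    linarith

theorem Ualpha_le_log {α : ℝ} (hα : 1 ≤ α) {z : ℝ} (hz : 0 < z) :
    Ualpha α z ≤ Real.log z := by
  have h := Ualpha_le_add_log_sub hα hz one_pos
  have h1 : Ualpha α 1 ≤ 0 := by
    unfold Ualpha
    split_ifs
    · simp
    · rw [Real.one_rpow]
      exact div_nonpos_of_nonneg_of_nonpos zero_le_one (by linarith)
  simp only [Real.one_rpow, Real.log_one, sub_zero, one_mul] at h
  linarith

theorem Ualpha_mono {α : ℝ} (hα : 1 ≤ α) {z w : ℝ} (hz : 0 < z) (hzw : z ≤ w) :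
    Ualpha α z ≤ Ualpha α w := by
  have hw := hz.trans_le hzw
  have h := Ualpha_le_add_log_sub hα hz hw
  have := mul_nonneg (Real.rpow_pos_of_pos hw (1 - α)).le
    (sub_nonneg.2 (Real.log_le_log hz hzw))
  linarith

theorem rate_pos {n : ℕ} {p : Fin n → ℝ} (hp : ∀ i, p i ∈ Set.Ioo (0 : ℝ) 1) (i : Fin n) :
    0 < rate p i :=
  mul_pos (hp i).1 (Finset.prod_pos fun j _ => sub_pos.2 (hp j).2)

theorem rate_le {n : ℕ} {p : Fin n → ℝ} (hp : ∀ i, p i ∈ Set.Ioo (0 : ℝ) 1) (i : Fin n) :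
    rate p i ≤ p i :=
  mul_le_of_le_one_right (hp i).1.le
    (Finset.prod_le_one (fun j _ => sub_nonneg.2 (hp j).2.le) fun j _ => by linarith [(hp j).1])

theorem rate_lt_one {n : ℕ} {p : Fin n → ℝ} (hp : ∀ i, p i ∈ Set.Ioo (0 : ℝ) 1) (i : Fin n) :
    rate p i < 1 :=
  (rate_le hp i).trans_lt (hp i).2

theorem rate_le_one_sub {n : ℕ} {p : Fin n → ℝ} (hp : ∀ i, p i ∈ Set.Ioo (0 : ℝ) 1)
    {i j : Fin n} (hij : j ≠ i) : rate p i ≤ 1 - p j := by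
  unfold rate
  rw [← Finset.mul_prod_erase _ _ (Finset.mem_erase.2 ⟨hij, Finset.mem_univ j⟩)]
  have h1 : ∏ k ∈ (Finset.univ.erase i).erase j, (1 - p k) ≤ 1 :=
    Finset.prod_le_one (fun k _ => sub_nonneg.2 (hp k).2.le) fun k _ => by linarith [(hp k).1]
  have h0 : 0 ≤ ∏ k ∈ (Finset.univ.erase i).erase j, (1 - p k) :=
    Finset.prod_nonneg fun k _ => sub_nonneg.2 (hp k).2.le
  have hj := hp j
  have hi := hp i
  calc p i * ((1 - p j) * ∏ k ∈ (Finset.univ.erase i).erase j, (1 - p k))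
      ≤ 1 * ((1 - p j) * 1) := by
        have := sub_pos.2 hj.2
        gcongr
        exact hi.2.le
    _ = 1 - p j := by ring

theorem log_rate {n : ℕ} {p : Fin n → ℝ} (hp : ∀ i, p i ∈ Set.Ioo (0 : ℝ) 1) (i : Fin n) :
    Real.log (rate p i) =
      Real.log (p i) + ∑ j ∈ Finset.univ.erase i, Real.log (1 - p j) := by
  have h : ∀ j, 1 - p j ≠ 0 := fun j => (sub_pos.2 (hp j).2).ne'
  rw [rate, Real.log_mul (hp i).1.ne' (Finset.prod_ne_zero_iff.2 fun j _ => h j),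
    Real.log_prod fun j _ => h j]

theorem sum_log_rate {n : ℕ} {p : Fin n → ℝ} (hp : ∀ i, p i ∈ Set.Ioo (0 : ℝ) 1) :
    ∑ i, Real.log (rate p i) =
      ∑ i, (Real.log (p i) + ((n : ℝ) - 1) * Real.log (1 - p i)) := by
  have h : ∀ i, Real.log (rate p i) =
      Real.log (p i) + (∑ j, Real.log (1 - p j) - Real.log (1 - p i)) := fun i => by
    rw [log_rate hp, ← Finset.add_sum_erase _ _ (Finset.mem_univ i), add_sub_cancel_left]
  simp only [h, Finset.sum_add_distrib, Finset.sum_sub_distrib, ← Finset.mul_sum,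
    Finset.sum_const, Finset.card_univ, Fintype.card_fin, nsmul_eq_mul]
  ring

theorem continuous_rate {n : ℕ} (i : Fin n) : Continuous fun p : Fin n → ℝ => rate p i := by
  unfold rate
  fun_prop

theorem continuous_tput {n : ℕ} : Continuous (tput : (Fin n → ℝ) → ℝ) :=
  continuous_finsetSum _ fun i _ => continuous_rate i

theorem continuousOn_Ualpha (α : ℝ) : ContinuousOn (Ualpha α) (Set.Ioi 0) := by
  intro z hz
  have hz' : z ≠ 0 := (Set.mem_Ioi.1 hz).ne'
  refine ContinuousAt.continuousWithinAt ?_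
  by_cases h : α = 1
  · have : Ualpha α = Real.log := by
      ext w
      simp [Ualpha, h]
    rw [this]
    exact Real.continuousAt_log hz'
  · have : Ualpha α = fun w => w ^ (1 - α) / (1 - α) := by
      ext w
      simp [Ualpha, h]
    rw [this]
    exact (Real.continuousAt_rpow_const z _ (Or.inl hz')).div_const _

theorem continuousOn_Falpha_rate (n : ℕ) (α : ℝ) :
    ContinuousOn (fun p : Fin n → ℝ => Falpha α fun i => rate p i)
      {p | ∀ i, p i ∈ Set.Ioo (0 : ℝ) 1} :=
  continuousOn_finsetSum _ fun i _ =>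
    (continuousOn_Ualpha α).comp (continuous_rate i).continuousOn fun _ hp => rate_pos hp i

theorem convex_openCube (n : ℕ) : Convex ℝ {p : Fin n → ℝ | ∀ i, p i ∈ Set.Ioo (0 : ℝ) 1} := by
  have h : {p : Fin n → ℝ | ∀ i, p i ∈ Set.Ioo (0 : ℝ) 1} =
      Set.univ.pi fun _ => Set.Ioo (0 : ℝ) 1 := by
    ext p
    simp only [Set.mem_univ_pi, Set.mem_ofPred_eq]
  rw [h]
  exact convex_pi fun _ _ => convex_Ioo 0 1

theorem concaveOn_log_rate {n : ℕ} (i : Fin n) :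
    ConcaveOn ℝ {p : Fin n → ℝ | ∀ j, p j ∈ Set.Ioo (0 : ℝ) 1}
      fun p => Real.log (rate p i) := by
  refine ⟨convex_openCube n, fun p hp q hq a b ha hb hab => ?_⟩
  have hpq := convex_openCube n hp hq ha hb hab
  have hlog := (strictConcaveOn_log_Ioi.concaveOn).2
  have h1 := hlog (hp i).1 (hq i).1 ha hb hab
  have h2 : ∀ j, a * Real.log (1 - p j) + b * Real.log (1 - q j) ≤
      Real.log (1 - (a • p + b • q) j) := fun j => by
    have := hlog (Set.mem_Ioi.2 (sub_pos.2 (hp j).2)) (Set.mem_Ioi.2 (sub_pos.2 (hq j).2))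
      ha hb hab
    simp only [smul_eq_mul] at this
    refine this.trans_eq (congrArg Real.log ?_)
    simp only [Pi.add_apply, Pi.smul_apply, smul_eq_mul]
    linear_combination hab
  have h3 := Finset.sum_le_sum fun j (_ : j ∈ Finset.univ.erase i) => h2 j
  rw [Finset.sum_add_distrib, ← Finset.mul_sum, ← Finset.mul_sum] at h3
  simp only [log_rate hp, log_rate hq, log_rate hpq, smul_eq_mul]
  simp only [Pi.add_apply, Pi.smul_apply, smul_eq_mul] at h1 h3 ⊢
  linarith

theorem concaveOn_Falpha_rate (n : ℕ) {α : ℝ} (hα : 1 ≤ α) :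
    ConcaveOn ℝ {p : Fin n → ℝ | ∀ j, p j ∈ Set.Ioo (0 : ℝ) 1}
      fun p => Falpha α fun i => rate p i := by
  refine ⟨convex_openCube n, fun p hp q hq a b ha hb hab => ?_⟩
  have hpq := convex_openCube n hp hq ha hb hab
  simp only [Falpha, smul_eq_mul, Finset.mul_sum, ← Finset.sum_add_distrib]
  refine Finset.sum_le_sum fun i _ => ?_
  have hc := (concaveOn_log_rate i).2 hp hq ha hb hab
  simp only [smul_eq_mul] at hc
  have hr := rate_pos hpq i
  set w := rate (a • p + b • q) i
  have h1 := mul_le_mul_of_nonneg_left (Ualpha_le_add_log_sub hα (rate_pos hp i) hr) ha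
  have h2 := mul_le_mul_of_nonneg_left (Ualpha_le_add_log_sub hα (rate_pos hq i) hr) hb
  have h3 := mul_le_mul_of_nonneg_left hc (Real.rpow_pos_of_pos hr (1 - α)).le
  obtain rfl : b = 1 - a := by linarith
  linarith

theorem uniform_mem_Ioo {n : ℕ} (hn : 2 ≤ n) : (1 / n : ℝ) ∈ Set.Ioo (0 : ℝ) 1 := by
  have : (2 : ℝ) ≤ n := by exact_mod_cast hn
  exact ⟨by positivity, by rw [div_lt_one (by linarith)]; linarith⟩

theorem rate_uniform {n : ℕ} (i : Fin n) :
    rate (fun _ : Fin n => (1 / n : ℝ)) i = 1 / n * crit n := by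
  simp [rate, crit, Finset.card_erase_of_mem]

theorem tput_uniform {n : ℕ} (hn : 2 ≤ n) : tput (fun _ : Fin n => (1 / n : ℝ)) = crit n := by
  have : (n : ℝ) ≠ 0 := by positivity
  simp only [tput, rate_uniform, Finset.sum_const, Finset.card_univ, Fintype.card_fin,
    nsmul_eq_mul]
  field_simp

theorem log_add_mul_log_lt {n : ℕ} (hn : 2 ≤ n) {x : ℝ} (hx : x ∈ Set.Ioo (0 : ℝ) 1)
    (hne : x ≠ 1 / n) :
    Real.log x + ((n : ℝ) - 1) * Real.log (1 - x) <
      Real.log (1 / n) + ((n : ℝ) - 1) * Real.log (1 - 1 / n) := by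
  have hn2 : (2 : ℝ) ≤ n := by exact_mod_cast hn
  have hn0 : (0 : ℝ) < n := by linarith
  obtain ⟨hc0, hc1⟩ := uniform_mem_Ioo hn
  have h1 := Real.log_lt_sub_one_of_pos (div_pos hx.1 hc0)
    (fun h => hne ((div_eq_one_iff_eq hc0.ne').1 h))
  have h2 := Real.log_le_sub_one_of_pos (div_pos (sub_pos.2 hx.2) (sub_pos.2 hc1))
  rw [Real.log_div hx.1.ne' hc0.ne'] at h1
  rw [Real.log_div (sub_pos.2 hx.2).ne' (sub_pos.2 hc1).ne'] at h2
  have h3 := mul_le_mul_of_nonneg_left h2 (by linarith : (0 : ℝ) ≤ n - 1)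
  have e1 : x / (1 / (n : ℝ)) - 1 = n * x - 1 := by field_simp
  have e2 : ((n : ℝ) - 1) * ((1 - x) / (1 - 1 / n) - 1) = 1 - n * x := by
    have : (n : ℝ) - 1 ≠ 0 := by linarith
    field_simp
    ring
  rw [e1] at h1
  rw [e2] at h3
  linarith

theorem Falpha_rate_lt_uniform {n : ℕ} (hn : 2 ≤ n) {α : ℝ} (hα : 1 ≤ α) {p : Fin n → ℝ}
    (hp : ∀ i, p i ∈ Set.Ioo (0 : ℝ) 1) (hne : p ≠ fun _ => (1 / n : ℝ)) :
    Falpha α (fun i => rate p i) <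
      Falpha α fun i => rate (fun _ : Fin n => (1 / n : ℝ)) i := by
  have hc : ∀ _ : Fin n, (1 / n : ℝ) ∈ Set.Ioo (0 : ℝ) 1 := fun _ => uniform_mem_Ioo hn
  obtain ⟨k, hk⟩ := Function.ne_iff.1 hne
  have hlog : ∑ i, Real.log (rate p i) <
      ∑ i, Real.log (rate (fun _ : Fin n => (1 / n : ℝ)) i) := by
    rw [sum_log_rate hp, sum_log_rate hc]
    refine Finset.sum_lt_sum (fun i _ => ?_) ⟨k, Finset.mem_univ k, log_add_mul_log_lt hn (hp k) hk⟩
    rcases eq_or_ne (p i) (1 / n) with h | h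
    · rw [h]
    · exact (log_add_mul_log_lt hn (hp i) h).le
  have hw : ∀ i, rate (fun _ : Fin n => (1 / n : ℝ)) i = 1 / n * crit n := rate_uniform
  have hw0 : 0 < 1 / n * crit n := hw k ▸ rate_pos hc k
  simp only [hw] at hlog
  have hsum := Finset.sum_le_sum fun i (_ : i ∈ Finset.univ) =>
    Ualpha_le_add_log_sub hα (rate_pos hp i) hw0
  rw [Finset.sum_add_distrib, ← Finset.mul_sum, Finset.sum_sub_distrib] at hsum
  have := mul_neg_of_pos_of_neg (Real.rpow_pos_of_pos hw0 (1 - α)) (sub_neg.2 hlog)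
  simp only [Falpha, hw]
  linarith

/-- Moving towards the uniform control lowers the throughput to any prescribed supercritical
value while improving the objective. -/
theorem exists_tput_eq_of_le {n : ℕ} (hn : 2 ≤ n) {α : ℝ} (hα : 1 ≤ α) {p : Fin n → ℝ}
    (hp : ∀ i, p i ∈ Set.Ioo (0 : ℝ) 1) {θ : ℝ} (hθ : crit n < θ) (hle : θ ≤ tput p) :
    ∃ q : Fin n → ℝ, (∀ i, q i ∈ Set.Ioo (0 : ℝ) 1) ∧ tput q = θ ∧
      Falpha α (fun i => rate p i) ≤ Falpha α (fun i => rate q i) ∧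
      (θ < tput p → Falpha α (fun i => rate p i) < Falpha α fun i => rate q i) := by
  set c : Fin n → ℝ := fun _ => (1 / n : ℝ)
  have hcm : ∀ i, c i ∈ Set.Ioo (0 : ℝ) 1 := fun _ => uniform_mem_Ioo hn
  have hTc : tput c = crit n := tput_uniform hn
  have hlt := Falpha_rate_lt_uniform hn hα hp (fun h => by rw [h] at hle; linarith)
  let g : ℝ → ℝ := fun t => tput ((1 - t) • p + t • c)
  have hg : Continuous g := continuous_tput.comp (by fun_prop)
  have hg0 : g 0 = tput p := by simp [g]
  have hg1 : g 1 = crit n := by simp [g, hTc]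
  obtain ⟨t, ht, hgt⟩ := intermediate_value_Icc' zero_le_one hg.continuousOn
    (show θ ∈ Set.Icc (g 1) (g 0) from ⟨by rw [hg1]; exact hθ.le, by rw [hg0]; exact hle⟩)
  have hconc := (concaveOn_Falpha_rate n hα).2 hp hcm (sub_nonneg.2 ht.2) ht.1 (by ring)
  simp only [smul_eq_mul] at hconc
  refine ⟨(1 - t) • p + t • c, convex_openCube n hp hcm (sub_nonneg.2 ht.2) ht.1 (by ring), hgt,
    ?_, fun h => ?_⟩
  · nlinarith [mul_nonneg ht.1 (sub_nonneg.2 hlt.le)]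
  · have ht0 : 0 < t := lt_of_le_of_ne ht.1 fun h0 => by
      rw [← h0, hg0] at hgt
      linarith
    nlinarith [mul_pos ht0 (sub_pos.2 hlt)]

theorem one_sub_sum_le_prod_one_sub {ι : Type*} (s : Finset ι) {x : ι → ℝ}
    (h0 : ∀ i ∈ s, 0 ≤ x i) (h1 : ∀ i ∈ s, x i ≤ 1) :
    1 - ∑ i ∈ s, x i ≤ ∏ i ∈ s, (1 - x i) := by
  classical
  induction s using Finset.induction_on with
  | empty => simp
  | insert a s ha ih =>
    rw [Finset.sum_insert ha, Finset.prod_insert ha]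
    have hxa := h0 a (Finset.mem_insert_self a s)
    have hxa' := h1 a (Finset.mem_insert_self a s)
    have ih' := ih (fun i hi => h0 i (Finset.mem_insert_of_mem hi))
      fun i hi => h1 i (Finset.mem_insert_of_mem hi)
    have hs := Finset.sum_nonneg fun i hi => h0 i (Finset.mem_insert_of_mem hi : i ∈ insert a s)
    nlinarith [mul_le_mul_of_nonneg_left ih' (sub_nonneg.2 hxa'), mul_nonneg hxa hs]

theorem exists_tput_eq {m : ℕ} (hm : 0 < m) {θ : ℝ} (h0 : 0 < θ) (h1 : θ < 1) :
    ∃ p : Fin m → ℝ, (∀ i, p i ∈ Set.Ioo (0 : ℝ) 1) ∧ tput p = θ := by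
  have hm0 : (1 : ℝ) ≤ m := by exact_mod_cast hm
  obtain ⟨ε, hε0, hε⟩ : ∃ ε : ℝ, 0 < ε ∧ m * ε < min θ (1 - θ) := by
    have : 0 < min θ (1 - θ) := lt_min h0 (sub_pos.2 h1)
    refine ⟨min θ (1 - θ) / (2 * m), by positivity, ?_⟩
    rw [mul_div_assoc', div_lt_iff₀ (by positivity)]
    nlinarith
  have hεθ := hε.trans_le (min_le_left _ _)
  have hεθ' := hε.trans_le (min_le_right _ _)
  have hε1 : ε < 1 := by nlinarith
  let k : Fin m := ⟨0, hm⟩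
  let a : Fin m → ℝ := fun _ => ε
  let b : Fin m → ℝ := Function.update a k (1 - ε)
  have ha : ∀ i, a i ∈ Set.Ioo (0 : ℝ) 1 := fun _ => ⟨hε0, hε1⟩
  have hb : ∀ i, b i ∈ Set.Ioo (0 : ℝ) 1 := fun i => by
    rcases eq_or_ne i k with h | h
    · subst h
      simp only [b, Function.update_self]
      exact ⟨by linarith, by linarith⟩
    · simp only [b, Function.update_of_ne h]
      exact ha i
  have hTa : tput a ≤ θ := by
    refine (Finset.sum_le_sum fun i _ => rate_le ha i).trans ?_
    simp only [a, Finset.sum_const, Finset.card_univ, Fintype.card_fin, nsmul_eq_mul]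
    exact hεθ.le
  have hTb : θ ≤ tput b := by
    have h2 : rate b k ≤ tput b :=
      Finset.single_le_sum (fun i _ => (rate_pos hb i).le) (Finset.mem_univ k)
    have h3 : rate b k = ∏ _i : Fin m, (1 - ε) := by
      rw [← Finset.mul_prod_erase _ _ (Finset.mem_univ k)]
      unfold rate
      refine congrArg₂ (· * ·) (Function.update_self ..) (Finset.prod_congr rfl fun j hj => ?_)
      simp only [b, a, Function.update_of_ne (Finset.ne_of_mem_erase hj)]
    have h4 := one_sub_sum_le_prod_one_sub (Finset.univ : Finset (Fin m)) (x := fun _ => ε)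
      (fun _ _ => hε0.le) fun _ _ => hε1.le
    simp only [Finset.sum_const, Finset.card_univ, Fintype.card_fin, nsmul_eq_mul] at h4 h3
    linarith
  obtain ⟨p, hp, hT⟩ := (convex_openCube m).isPreconnected.intermediate_value ha hb
    continuous_tput.continuousOn ⟨hTa, hTb⟩
  exact ⟨p, hp, hT⟩

theorem Falpha_rate_le_log {n : ℕ} {α : ℝ} (hα : 1 ≤ α) {p : Fin n → ℝ}
    (hp : ∀ i, p i ∈ Set.Ioo (0 : ℝ) 1) (i : Fin n) :
    Falpha α (fun i => rate p i) ≤ Real.log (rate p i) := by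
  have hneg : ∀ j, Ualpha α (rate p j) ≤ 0 := fun j =>
    (Ualpha_le_log hα (rate_pos hp j)).trans
      (Real.log_nonpos (rate_pos hp j).le (rate_lt_one hp j).le)
  unfold Falpha
  rw [← Finset.add_sum_erase _ _ (Finset.mem_univ i)]
  linarith [Ualpha_le_log hα (rate_pos hp i),
    Finset.sum_nonpos fun j (_ : j ∈ Finset.univ.erase i) => hneg j]

/-- The supremum defining `FAstar` is attained. -/
theorem exists_isGreatest_FAstar {m : ℕ} (hm : 2 ≤ m) {α : ℝ} (hα : 1 ≤ α) {θ : ℝ}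
    (h0 : 0 < θ) (h1 : θ < 1) :
    IsGreatest {v : ℝ | ∃ p : Fin m → ℝ, (∀ i, p i ∈ Set.Ioo (0 : ℝ) 1) ∧
      tput p = θ ∧ v = Falpha α (fun i => rate p i)} (FAstar m α θ) := by
  obtain ⟨p₀, hp₀, hT₀⟩ := exists_tput_eq (by omega : 0 < m) h0 h1
  set M := Falpha α (fun i => rate p₀ i)
  have hε := Real.exp_pos M
  set ε := Real.exp M
  have : Nontrivial (Fin m) := Fin.nontrivial_iff_two_le.2 hm
  have key : ∀ p : Fin m → ℝ, (∀ i, p i ∈ Set.Ioo (0 : ℝ) 1) →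
      M ≤ Falpha α (fun i => rate p i) → p ∈ Set.univ.pi fun _ => Set.Icc ε (1 - ε) := by
    intro p hp hMp i _
    have hr : ∀ j, ε ≤ rate p j := fun j =>
      (Real.le_log_iff_exp_le (rate_pos hp j)).1 (hMp.trans (Falpha_rate_le_log hα hp j))
    obtain ⟨j, hj⟩ := exists_ne i
    exact ⟨(hr i).trans (rate_le hp i), by linarith [hr j, rate_le_one_sub hp hj.symm]⟩
  have hcube : ∀ p ∈ Set.univ.pi fun _ : Fin m => Set.Icc ε (1 - ε),
      ∀ i, p i ∈ Set.Ioo (0 : ℝ) 1 := fun p hp i => by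
    have := hp i (Set.mem_univ i)
    exact ⟨hε.trans_le this.1, this.2.trans_lt (by linarith)⟩
  have hK : IsCompact ((Set.univ.pi fun _ : Fin m => Set.Icc ε (1 - ε)) ∩ {p | tput p = θ}) :=
    (isCompact_univ_pi fun _ => isCompact_Icc).inter_right
      (isClosed_eq continuous_tput continuous_const)
  obtain ⟨p, ⟨hpK, hpT⟩, hmax⟩ := hK.exists_isMaxOn ⟨p₀, key p₀ hp₀ le_rfl, hT₀⟩
    ((continuousOn_Falpha_rate m α).mono fun p hp => hcube p hp.1)
  have hgr : IsGreatest {v : ℝ | ∃ p : Fin m → ℝ, (∀ i, p i ∈ Set.Ioo (0 : ℝ) 1) ∧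
      tput p = θ ∧ v = Falpha α (fun i => rate p i)} (Falpha α fun i => rate p i) := by
    refine ⟨⟨p, hcube p hpK, hpT, rfl⟩, ?_⟩
    rintro v ⟨q, hq, hqT, rfl⟩
    rcases le_total M (Falpha α fun i => rate q i) with h | h
    · exact hmax ⟨key q hq h, hqT⟩
    · exact h.trans (hmax ⟨key p₀ hp₀ le_rfl, hT₀⟩)
  rw [FAstar, hgr.csSup_eq]
  exact hgr

/-- If the access probabilities sum to less than one, multiplying all odds by a common factor
makes them sum to one and raises every rate. -/
theorem exists_sum_eq_one_rate_le {m : ℕ} (hm : 2 ≤ m) {p : Fin m → ℝ}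
    (hp : ∀ i, p i ∈ Set.Ioo (0 : ℝ) 1) (hs : ∑ i, p i ≤ 1) :
    ∃ q : Fin m → ℝ, (∀ i, q i ∈ Set.Ioo (0 : ℝ) 1) ∧ ∑ i, q i = 1 ∧
      ∀ i, rate p i ≤ rate q i := by
  have hD : ∀ l : ℝ, 1 ≤ l → ∀ i, 0 < 1 - p i + l * p i := fun l hl i => by
    nlinarith [(hp i).1, (hp i).2]
  let q : ℝ → Fin m → ℝ := fun l i => l * p i / (1 - p i + l * p i)
  have hq : ∀ l : ℝ, 1 ≤ l → ∀ i, q l i ∈ Set.Ioo (0 : ℝ) 1 := fun l hl i => by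
    have := hD l hl i
    refine ⟨div_pos (mul_pos (by linarith) (hp i).1) this, ?_⟩
    rw [div_lt_one this]
    linarith [(hp i).2]
  let i₀ : Fin m := ⟨0, by omega⟩
  let i₁ : Fin m := ⟨1, by omega⟩
  have hi : i₀ ≠ i₁ := by simp [i₀, i₁, Fin.ext_iff]
  set L : ℝ := 1 / p i₀ + 1 / p i₁ with hL
  have hpos₀ := one_div_pos.2 (hp i₀).1
  have hpos₁ := one_div_pos.2 (hp i₁).1
  have hL1 : 1 ≤ L := by
    have : 1 ≤ 1 / p i₀ := by
      rw [le_div_iff₀ (hp i₀).1]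
      linarith [(hp i₀).2]
    linarith
  have hhalf : ∀ i, 1 / p i ≤ L → 1 / 2 ≤ q L i := fun i h => by
    rw [div_le_iff₀ (hp i).1] at h
    rw [le_div_iff₀ (hD L hL1 i)]
    linarith [(hp i).1]
  have hcont : ContinuousOn (fun l => ∑ i, q l i) (Set.Icc 1 L) :=
    continuousOn_finsetSum _ fun i _ =>
      ContinuousOn.div (by fun_prop) (by fun_prop) fun l hl => (hD l hl.1 i).ne'
  have hsum1 : ∑ i, q 1 i = ∑ i, p i := by simp [q]
  have hsumL : 1 ≤ ∑ i, q L i := by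
    have := Finset.sum_le_sum_of_subset_of_nonneg (Finset.subset_univ {i₀, i₁})
      fun i _ _ => (hq L hL1 i).1.le
    rw [Finset.sum_pair hi] at this
    linarith [hhalf i₀ (by linarith), hhalf i₁ (by linarith)]
  obtain ⟨l, hl, hql⟩ := intermediate_value_Icc hL1 hcont
    (show (1 : ℝ) ∈ Set.Icc (∑ i, q 1 i) (∑ i, q L i) from ⟨hsum1 ▸ hs, hsumL⟩)
  beta_reduce at hql
  have hl0 : 0 < l := by linarith [hl.1]
  refine ⟨q l, hq l hl.1, hql, fun i => ?_⟩
  have hinv : 1 / l ≤ ∏ j, (1 / (1 - p j + l * p j)) := by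
    have hx0 : 0 ≤ 1 - 1 / l := by
      rw [sub_nonneg, div_le_one hl0]
      exact hl.1
    have hx1 : 1 - 1 / l ≤ 1 := by linarith [one_div_pos.2 hl0]
    have h := one_sub_sum_le_prod_one_sub Finset.univ (x := fun j => (1 - 1 / l) * q l j)
      (fun j _ => mul_nonneg hx0 (hq l hl.1 j).1.le)
      fun j _ => mul_le_one₀ hx1 (hq l hl.1 j).1.le (hq l hl.1 j).2.le
    rw [← Finset.mul_sum, hql, mul_one, sub_sub_cancel] at h
    refine h.trans_eq (Finset.prod_congr rfl fun j _ => ?_)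
    have := (hD l hl.1 j).ne'
    simp only [q]
    field_simp
    ring
  have hrate : rate (q l) i = rate p i * (l * ∏ j, (1 / (1 - p j + l * p j))) := by
    rw [← Finset.mul_prod_erase _ _ (Finset.mem_univ i)]
    have : ∀ j, 1 - q l j = (1 - p j) * (1 / (1 - p j + l * p j)) := fun j => by
      have := (hD l hl.1 j).ne'
      simp only [q]
      field_simp
      ring
    simp only [rate, this, Finset.prod_mul_distrib]
    simp only [q]
    ring
  rw [hrate]
  refine le_mul_of_one_le_right (rate_pos hp i).le ?_
  rw [div_le_iff₀ hl0] at hinv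
  linarith

theorem rate_succAbove {n : ℕ} (p : Fin (n + 1) → ℝ) (k : Fin (n + 1)) (i : Fin n) :
    rate p (k.succAbove i) = (1 - p k) * rate (fun j => p (k.succAbove j)) i := by
  have himg : (Finset.univ : Finset (Fin (n + 1))).erase (k.succAbove i) =
      insert k ((Finset.univ.erase i).image k.succAbove) := by
    ext j
    rcases Fin.eq_self_or_eq_succAbove k j with rfl | ⟨j, rfl⟩
    · simp [Fin.ne_succAbove]
    · simp [Fin.succAbove_ne]
  unfold rate
  rw [himg, Finset.prod_insert (by simp [Fin.succAbove_ne]),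
    Finset.prod_image fun a _ b _ h => Fin.succAbove_right_injective h]
  ring

theorem rate_eq_mul_prod_succAbove {n : ℕ} (p : Fin (n + 1) → ℝ) (k : Fin (n + 1)) :
    rate p k = p k * ∏ i, (1 - p (k.succAbove i)) := by
  have himg : (Finset.univ : Finset (Fin (n + 1))).erase k =
      Finset.univ.image k.succAbove := by
    ext j
    rcases Fin.eq_self_or_eq_succAbove k j with rfl | ⟨j, rfl⟩
    · simp
    · simp [Fin.succAbove_ne]
  unfold rate
  rw [himg, Finset.prod_image fun a _ b _ h => Fin.succAbove_right_injective h]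

theorem tput_eq_prod_mul_sum {n : ℕ} {p : Fin n → ℝ} (hp : ∀ i, p i ∈ Set.Ioo (0 : ℝ) 1) :
    tput p = (∏ i, (1 - p i)) * ∑ i, p i / (1 - p i) := by
  rw [tput, Finset.mul_sum]
  refine Finset.sum_congr rfl fun i _ => ?_
  have := (sub_pos.2 (hp i).2).ne'
  rw [← Finset.mul_prod_erase _ _ (Finset.mem_univ i), rate]
  field_simp

/-- Removing a user whose access probability is at most the average does not lower the throughput,
provided the access probabilities sum to at least one. -/
theorem tput_le_tput_succAbove {n : ℕ} (hn : 0 < n) {p : Fin (n + 1) → ℝ}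
    (hp : ∀ i, p i ∈ Set.Ioo (0 : ℝ) 1) (hs : 1 ≤ ∑ i, p i) {k : Fin (n + 1)}
    (hk : p k ≤ (∑ i, p i) / (n + 1)) : tput p ≤ tput fun i => p (k.succAbove i) := by
  have hn0 : (0 : ℝ) < n := by exact_mod_cast hn
  have hq : ∀ i, p (k.succAbove i) ∈ Set.Ioo (0 : ℝ) 1 := fun i => hp _
  have htan : ∀ x : ℝ, x < 1 →
      1 / (n : ℝ) + (((n : ℝ) + 1) / n) ^ 2 * (x - 1 / (n + 1)) ≤ x / (1 - x) := by
    intro x hx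
    have hx' := sub_pos.2 hx
    have : x / (1 - x) - (1 / (n : ℝ) + (((n : ℝ) + 1) / n) ^ 2 * (x - 1 / (n + 1))) =
        ((n + 1) * x - 1) ^ 2 / (n ^ 2 * (1 - x)) := by
      have := hx'.ne'
      field_simp
      ring
    have h2 : 0 ≤ ((n + 1) * x - 1) ^ 2 / ((n : ℝ) ^ 2 * (1 - x)) := by positivity
    linarith
  have hodds : 1 ≤ ∑ i, p (k.succAbove i) / (1 - p (k.succAbove i)) := by
    have h := Finset.sum_le_sum fun i (_ : i ∈ Finset.univ) => htan _ (hq i).2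
    rw [Finset.sum_add_distrib, ← Finset.mul_sum, Finset.sum_sub_distrib] at h
    simp only [Finset.sum_const, Finset.card_univ, Fintype.card_fin, nsmul_eq_mul] at h
    rw [Fin.sum_univ_succAbove _ k] at hs hk
    have e : (n : ℝ) * (1 / n) = 1 := by field_simp
    have h2 : 0 ≤ ∑ i, p (k.succAbove i) - n * (1 / ((n : ℝ) + 1)) := by
      rw [le_div_iff₀ (by positivity)] at hk
      rw [mul_one_div, sub_nonneg, div_le_iff₀ (by positivity)]
      nlinarith
    have := mul_nonneg (sq_nonneg (((n : ℝ) + 1) / n)) h2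
    linarith
  have hprod : 0 ≤ ∏ i, (1 - p (k.succAbove i)) :=
    Finset.prod_nonneg fun i _ => (sub_pos.2 (hq i).2).le
  have hge : ∏ i, (1 - p (k.succAbove i)) ≤ tput fun i => p (k.succAbove i) := by
    rw [tput_eq_prod_mul_sum hq]
    exact le_mul_of_one_le_right hprod hodds
  have hT : tput p = p k * ∏ i, (1 - p (k.succAbove i)) +
      (1 - p k) * tput fun i => p (k.succAbove i) := by
    rw [tput, Fin.sum_univ_succAbove _ k, rate_eq_mul_prod_succAbove, tput, Finset.mul_sum]
    simp only [rate_succAbove]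
  rw [hT]
  nlinarith [mul_le_mul_of_nonneg_left hge (hp k).1.le]

theorem Falpha_rate_lt_succAbove {n : ℕ} {α : ℝ} (hα : 1 ≤ α) {p : Fin (n + 1) → ℝ}
    (hp : ∀ i, p i ∈ Set.Ioo (0 : ℝ) 1) (k : Fin (n + 1)) :
    Falpha α (fun i => rate p i) < Falpha α fun i => rate (fun j => p (k.succAbove j)) i := by
  unfold Falpha
  rw [Fin.sum_univ_succAbove _ k]
  have hk : Ualpha α (rate p k) < 0 :=
    (Ualpha_le_log hα (rate_pos hp k)).trans_lt
      (Real.log_neg (rate_pos hp k) (rate_lt_one hp k))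
  have h : ∑ i, Ualpha α (rate p (k.succAbove i)) ≤
      ∑ i, Ualpha α (rate (fun j => p (k.succAbove j)) i) := by
    refine Finset.sum_le_sum fun i _ => Ualpha_mono hα (rate_pos hp _) ?_
    rw [rate_succAbove]
    exact mul_le_of_le_one_left (rate_pos (fun j => hp _) i).le (by linarith [(hp k).1])
  linarith

/-- Some control of `n` users has at least the throughput of a given control of `n + 1` users and
a better objective. -/
theorem exists_tput_ge_Falpha_gt {n : ℕ} (hn : 0 < n) {α : ℝ} (hα : 1 ≤ α)
    {p : Fin (n + 1) → ℝ} (hp : ∀ i, p i ∈ Set.Ioo (0 : ℝ) 1) :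
    ∃ q : Fin n → ℝ, (∀ i, q i ∈ Set.Ioo (0 : ℝ) 1) ∧ tput p ≤ tput q ∧
      Falpha α (fun i => rate p i) < Falpha α fun i => rate q i := by
  obtain ⟨r, hr, hs, hle⟩ : ∃ r : Fin (n + 1) → ℝ, (∀ i, r i ∈ Set.Ioo (0 : ℝ) 1) ∧
      1 ≤ ∑ i, r i ∧ ∀ i, rate p i ≤ rate r i := by
    rcases le_total (∑ i, p i) 1 with h | h
    · obtain ⟨r, hr, hs, hle⟩ := exists_sum_eq_one_rate_le (by omega) hp h
      exact ⟨r, hr, hs.ge, hle⟩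
    · exact ⟨p, hp, h, fun _ => le_rfl⟩
  obtain ⟨k, -, hk⟩ : ∃ k ∈ Finset.univ, r k ≤ (∑ i, r i) / (n + 1) := by
    refine Finset.exists_le_of_sum_le Finset.univ_nonempty (le_of_eq ?_)
    simp only [Finset.sum_const, Finset.card_univ, Fintype.card_fin, nsmul_eq_mul]
    push_cast
    field_simp
  refine ⟨fun i => r (k.succAbove i), fun i => hr _, ?_, ?_⟩
  · exact (Finset.sum_le_sum fun i _ => hle i).trans (tput_le_tput_succAbove hn hr hs hk)
  · exact (Finset.sum_le_sum fun i _ => Ualpha_mono hα (rate_pos hp i) (hle i)).trans_lt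
      (Falpha_rate_lt_succAbove hα hr k)

theorem alpha_fair_tradeoff_monotonicity (n : ℕ) (hn : 2 ≤ n) (α : ℝ) (hα : 1 ≤ α) :
    (∀ θ θ' : ℝ, crit n < θ → θ < θ' → θ' < 1 → FAstar n α θ' < FAstar n α θ) ∧
    (∀ θ : ℝ, crit n < θ → θ < 1 → FAstar (n + 1) α θ < FAstar n α θ) := by
  have hcrit : 0 ≤ crit n := pow_nonneg (sub_nonneg.2 (uniform_mem_Ioo hn).2.le) _
  refine ⟨fun θ θ' hθ hlt h1 => ?_, fun θ hθ h1 => ?_⟩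
  · obtain ⟨⟨p, hp, hT, hF⟩, -⟩ := exists_isGreatest_FAstar hn hα (by linarith : 0 < θ') h1
    obtain ⟨q, hq, hqT, -, hlt'⟩ := exists_tput_eq_of_le hn hα hp hθ (hT ▸ hlt.le)
    rw [hF]
    exact (hlt' (hT ▸ hlt)).trans_le
      ((exists_isGreatest_FAstar hn hα (by linarith) (by linarith)).2 ⟨q, hq, hqT, rfl⟩)
  · obtain ⟨⟨p, hp, hT, hF⟩, -⟩ :=
      exists_isGreatest_FAstar (by omega : 2 ≤ n + 1) hα (by linarith : 0 < θ) h1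
    obtain ⟨r, hr, hrT, hrF⟩ := exists_tput_ge_Falpha_gt (by omega) hα hp
    obtain ⟨q, hq, hqT, hle, -⟩ := exists_tput_eq_of_le hn hα hr hθ (hT ▸ hrT)
    rw [hF]
    exact (hrF.trans_le hle).trans_le
      ((exists_isGreatest_FAstar hn hα (by linarith) h1).2 ⟨q, hq, hqT, rfl⟩)
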